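/- Let p be an odd prime, q = p^m with q = 2^a·b + 1, b odd, 2 ≤ a < r, and N = 2^r·p^s. Let C be the ideal of R = F_q[x]/(x^N − 1) generated by ∏_{t ∈ T_n} m_t(x)^{j_t}, where 0 ≤ j_t ≤ p^s for each t ∈ T_n, and let S = {0, 2^{r−1}} ∪ { 2^{r−i}·s : s ∈ D_i, 2 ≤ i ≤ a }. Then C is MDS if and only if exactly one of the following holds: (1) j_t = 0 for every t ∈ T_n, in which case d_H(C) = 1; (2) there is exactly one t ∈ S with j_t = 1 and j_{t'} = 0 for all other t' ∈ T_n, in which case d_H(C) = 2; (3) there is exactly one t ∈ S with j_t = p^s − 1 and j_{t'} = p^s for all other t' ∈ T_n, in which case d_H(C) = 2^r·p^s. -/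

import Mathlib

open Polynomial
open scoped Classical

/-- The coefficient vector (with respect to the basis `1, x, …, x^{deg f − 1}` of
`F[x]/(f)`) of an element of `F[x]/(f)`. -/
noncomputable def coeffRepr {F : Type*} [Field F] {f : Polynomial F} (hf : f ≠ 0)
    (x : AdjoinRoot f) (i : Fin (AdjoinRoot.powerBasis hf).dim) : F :=
  (AdjoinRoot.powerBasis hf).basis.repr x i

/-- The Hamming weight of a codeword. -/
noncomputable def hammingWeight {F : Type*} [Field F] {f : Polynomial F} (hf : f ≠ 0)
    (x : AdjoinRoot f) : ℕ :=
  (Finset.univ.filter fun i => coeffRepr hf x i ≠ 0).card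

/-- The Hamming distance of a code `C ⊆ F[x]/(f)`. -/
noncomputable def dHamming {F : Type*} [Field F] {f : Polynomial F} (hf : f ≠ 0)
    (C : Ideal (AdjoinRoot f)) : ℕ :=
  sInf {w | ∃ x ∈ C, x ≠ 0 ∧ w = hammingWeight hf x}

/-- The set `D_i` (for `q = 2^a·b + 1`). -/
def Dfin (a i : ℕ) : Finset ℤ :=
  if i ≤ a then
    ((Finset.range (2 ^ (i - 2))).image fun v => (3 : ℤ) ^ v) ∪
      ((Finset.range (2 ^ (i - 2))).image fun v => -(3 : ℤ) ^ v)
  else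
    ((Finset.range (2 ^ (a - 2))).image fun v => (3 : ℤ) ^ v) ∪
      ((Finset.range (2 ^ (a - 2))).image fun v => -(3 : ℤ) ^ v)

/-- The complete set of representatives `T_n = {0, 2^{r−1}} ∪ ⋃_{i=2}^r 2^{r−i}·D_i`. -/
def TnD (a r : ℕ) : Finset ℤ :=
  {0, 2 ^ (r - 1)} ∪
    (Finset.Icc 2 r).biUnion fun i => (Dfin a i).image fun u => 2 ^ (r - i) * u

/-- The subset `S = {0, 2^{r−1}} ∪ {2^{r−i}·u : u ∈ D_i, 2 ≤ i ≤ a}` of `T_n`. -/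
def SD (a r : ℕ) : Finset ℤ :=
  {0, 2 ^ (r - 1)} ∪
    (Finset.Icc 2 a).biUnion fun i => (Dfin a i).image fun u => 2 ^ (r - i) * u

lemma modEq_step {i : ℕ} {u w c e : ℤ} (hw : Odd w) (he : Odd e) (hc : c = 1 + 2 ^ i * e)
    (h : u ≡ w [ZMOD 2 ^ i]) :
    u ≡ w [ZMOD 2 ^ (i + 1)] ∨ u ≡ w * c [ZMOD 2 ^ (i + 1)] := by
  obtain ⟨k, hk⟩ := h.symm.dvd
  rcases Int.even_or_odd k with ⟨k', hk'⟩ | hk'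
  · left
    refine (Int.modEq_iff_dvd.2 ⟨k', ?_⟩).symm
    rw [hk, hk', pow_succ]; ring
  · right
    obtain ⟨z, hz⟩ := hk'.sub_odd (hw.mul he)
    refine (Int.modEq_iff_dvd.2 ⟨z, ?_⟩).symm
    rw [hc, pow_succ]
    linear_combination hk + 2 ^ i * hz

lemma pow_two_pow_eq {c e : ℤ} {i : ℕ} (hi : 2 ≤ i) (he : Odd e) (hc : c = 1 + 2 ^ i * e)
    (l : ℕ) : ∃ e', Odd e' ∧ c ^ 2 ^ l = 1 + 2 ^ (i + l) * e' := by
  induction l with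
  | zero => exact ⟨e, he, by simpa using hc⟩
  | succ l ih =>
    obtain ⟨e', he', h⟩ := ih
    refine ⟨e' + 2 ^ (i + l - 1) * e' ^ 2, ?_, ?_⟩
    · refine he'.add_even ?_
      exact ((even_two.pow_of_ne_zero (by omega)).mul_right _)
    · rw [pow_succ 2 l, pow_mul, h]
      obtain ⟨k, rfl⟩ : ∃ k, i = k + 1 := ⟨i - 1, by omega⟩
      have : k + 1 + l - 1 = k + l := by omega
      rw [this]; ring

/-- Every odd integer is congruent modulo `2 ^ i` to some `±3 ^ v` with `v < 2 ^ (i - 2)`. -/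
lemma exists_three_pow_modEq {u : ℤ} (hu : Odd u) {i : ℕ} (hi : 2 ≤ i) :
    ∃ v < 2 ^ (i - 2), u ≡ 3 ^ v [ZMOD 2 ^ i] ∨ u ≡ -3 ^ v [ZMOD 2 ^ i] := by
  induction i, hi using Nat.le_induction with
  | base =>
    refine ⟨0, by norm_num, ?_⟩
    obtain ⟨k, rfl⟩ := hu
    simp only [Int.ModEq]
    omega
  | succ i hi ih =>
    rcases hi.eq_or_lt with rfl | hi3
    · obtain ⟨k, rfl⟩ := hu
      have : (2 * k + 1) % 8 = 1 ∨ (2 * k + 1) % 8 = 3 ∨ (2 * k + 1) % 8 = 5 ∨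
        (2 * k + 1) % 8 = 7 := by omega
      rcases this with h | h | h | h
      · exact ⟨0, by norm_num, Or.inl h⟩
      · exact ⟨1, by norm_num, Or.inl h⟩
      · exact ⟨1, by norm_num, Or.inr h⟩
      · exact ⟨0, by norm_num, Or.inr h⟩
    · obtain ⟨v, hv, h⟩ := ih
      obtain ⟨e, he, hc⟩ := pow_two_pow_eq (c := 9) (e := 1) (i := 3) (by norm_num) odd_one
        (by norm_num) (i - 3)
      have hc' : (3 : ℤ) ^ 2 ^ (i - 2) = 1 + 2 ^ i * e := by
        have h1 : i - 2 = (i - 3) + 1 := by omega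
        have h2 : 3 + (i - 3) = i := by omega
        rw [h1, pow_succ, mul_comm, pow_mul, ← h2]
        norm_num at hc ⊢
        exact hc
      have h3 : Odd ((3 : ℤ) ^ v) := Odd.pow (by decide)
      have e1 : 2 ^ (i + 1 - 2) = 2 ^ (i - 2) + 2 ^ (i - 2) := by
        rw [← two_mul, ← pow_succ']; congr 1; omega
      rcases h with h | h
      · rcases modEq_step h3 he hc' h with h | h
        · exact ⟨v, by omega, Or.inl h⟩
        · exact ⟨v + 2 ^ (i - 2), by omega, Or.inl (by rwa [pow_add 3 v])⟩
      · rcases modEq_step h3.neg he hc' h with h | h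
        · exact ⟨v, by omega, Or.inr h⟩
        · exact ⟨v + 2 ^ (i - 2), by omega, Or.inr (by rwa [pow_add 3 v, ← neg_mul])⟩

/-- If `c = 1 + 2 ^ a * e` with `e` odd and `a ≥ 2`, then the powers of `c` represent all
residues modulo `2 ^ i` that are congruent to `1` modulo `2 ^ a`. -/
lemma exists_mul_pow_modEq {a i : ℕ} {u w c e : ℤ} (ha : 2 ≤ a) (hai : a ≤ i) (hw : Odd w)
    (he : Odd e) (hc : c = 1 + 2 ^ a * e) (h : u ≡ w [ZMOD 2 ^ a]) :
    ∃ l : ℕ, u ≡ w * c ^ l [ZMOD 2 ^ i] := by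
  induction i, hai using Nat.le_induction with
  | base => exact ⟨0, by simpa using h⟩
  | succ i hi ih =>
    obtain ⟨l, hl⟩ := ih
    obtain ⟨e', he', hc'⟩ := pow_two_pow_eq ha he hc (i - a)
    rw [Nat.add_sub_cancel' hi] at hc'
    have hodd : Odd c := by
      rw [hc]
      exact odd_one.add_even ((even_two.pow_of_ne_zero (by omega)).mul_right _)
    rcases modEq_step (hw.mul (hodd.pow (n := l))) he' hc' hl with h | h
    · exact ⟨l, h⟩
    · exact ⟨l + 2 ^ (i - a), by rwa [pow_add c l, ← mul_assoc]⟩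

lemma sum_biUnion_le_sum_sum {ι α : Type*} [DecidableEq α] (s : Finset ι) (t : ι → Finset α)
    (f : α → ℕ) :
    ∑ x ∈ s.biUnion t, f x ≤ ∑ i ∈ s, ∑ x ∈ t i, f x := by
  induction s using Finset.induction_on with
  | empty => simp
  | insert i s hi ih =>
    rw [Finset.biUnion_insert, Finset.sum_insert hi]
    have := Finset.sum_union_inter (s₁ := t i) (s₂ := s.biUnion t) (f := f)
    omega

lemma card_Dfin_le (a i : ℕ) : (Dfin a i).card ≤ 2 * 2 ^ (min i a - 2) := by
  unfold Dfin
  split_ifs with h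
  · rw [min_eq_left h, two_mul]
    refine (Finset.card_union_le _ _).trans (add_le_add ?_ ?_) <;>
    exact Finset.card_image_le.trans (by simp)
  · rw [min_eq_right (by omega), two_mul]
    refine (Finset.card_union_le _ _).trans (add_le_add ?_ ?_) <;>
    exact Finset.card_image_le.trans (by simp)

lemma mem_Dfin {a i : ℕ} {u : ℤ} :
    u ∈ Dfin a i ↔ ∃ v < 2 ^ (min i a - 2), u = 3 ^ v ∨ u = -3 ^ v := by
  unfold Dfin
  split_ifs with h
  · rw [min_eq_left h]; simp only [Finset.mem_union, Finset.mem_image, Finset.mem_range]; grind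
  · rw [min_eq_right (by omega)]
    simp only [Finset.mem_union, Finset.mem_image, Finset.mem_range]; grind

lemma odd_of_mem_Dfin {a i : ℕ} {u : ℤ} (h : u ∈ Dfin a i) : Odd u := by
  obtain ⟨v, -, rfl | rfl⟩ := mem_Dfin.1 h
  · exact Odd.pow (by decide)
  · exact (Odd.pow (by decide)).neg

/-- Every odd integer is congruent to an element of `Dfin a i` modulo `2 ^ min i a`. -/
lemma exists_mem_Dfin_modEq {a i : ℕ} (ha : 2 ≤ a) (hi : 2 ≤ i) {u : ℤ} (hu : Odd u) :
    ∃ w ∈ Dfin a i, u ≡ w [ZMOD 2 ^ min i a] := by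
  obtain ⟨v, hv, h | h⟩ := exists_three_pow_modEq hu (i := min i a) (by omega)
  · exact ⟨_, mem_Dfin.2 ⟨v, hv, Or.inl rfl⟩, h⟩
  · exact ⟨_, mem_Dfin.2 ⟨v, hv, Or.inr rfl⟩, h⟩

lemma mem_TnD {a r : ℕ} {t : ℤ} : t ∈ TnD a r ↔
    t = 0 ∨ t = 2 ^ (r - 1) ∨ ∃ i, 2 ≤ i ∧ i ≤ r ∧ ∃ u ∈ Dfin a i, 2 ^ (r - i) * u = t := by
  simp [TnD, and_assoc]

lemma mem_SD {a r : ℕ} {t : ℤ} : t ∈ SD a r ↔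
    t = 0 ∨ t = 2 ^ (r - 1) ∨ ∃ i, 2 ≤ i ∧ i ≤ a ∧ ∃ u ∈ Dfin a i, 2 ^ (r - i) * u = t := by
  simp [SD, and_assoc]

lemma SD_subset_TnD {a r : ℕ} (har : a ≤ r) : SD a r ⊆ TnD a r := by
  intro t ht
  rw [mem_TnD]
  rcases mem_SD.1 ht with h | h | ⟨i, h2, hia, h⟩
  · exact Or.inl h
  · exact Or.inr (Or.inl h)
  · exact Or.inr (Or.inr ⟨i, h2, hia.trans har, h⟩)

section Minpoly

lemma isIntegral_zpow {F E : Type*} [Field F] [Field E] [Algebra F E] {β : E} {r : ℕ}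
    (hβ : IsPrimitiveRoot β (2 ^ r)) (t : ℤ) : IsIntegral F (β ^ t) := by
  refine ⟨X ^ 2 ^ r - 1, monic_X_pow_sub_C 1 (by positivity), ?_⟩
  have : (β ^ t) ^ 2 ^ r = 1 := by
    rw [← zpow_natCast, zpow_comm, zpow_natCast, hβ.pow_eq_one, one_zpow]
  simp [this]

variable {F E : Type*} [Field F] [Fintype F] [Field E] [Algebra F E]

lemma mem_range_of_pow_card_eq {x : E} (hx : x ^ Fintype.card F = x) :
    x ∈ (algebraMap F E).range := by
  have hne : (X ^ Fintype.card F - X : F[X]) ≠ 0 :=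
    FiniteField.X_pow_card_sub_X_ne_zero F Fintype.one_lt_card
  have hs : (X ^ Fintype.card F - X : F[X]).Splits := by
    rw [splits_iff_card_roots, FiniteField.roots_X_pow_card_sub_X,
      FiniteField.X_pow_card_sub_X_natDegree_eq F Fintype.one_lt_card]
    simp
  refine hs.mem_range_of_isRoot (f := X ^ Fintype.card F - X) hne ?_
  simp [hx]

lemma aeval_pow_card_pow_eq_zero {f : F[X]} {x : E} (h : aeval x f = 0) (l : ℕ) :
    aeval (x ^ Fintype.card F ^ l) f = 0 := by
  induction l with
  | zero => simpa
  | succ l ih =>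
    have : x ^ Fintype.card F ^ (l + 1) =
        FiniteField.frobeniusAlgHom F E (x ^ Fintype.card F ^ l) := by
      simp [pow_succ, pow_mul]
    rw [this, aeval_algHom_apply, ih, map_zero]

variable {a b r : ℕ} {β : E}

lemma zpow_eq_of_modEq (hβ : IsPrimitiveRoot β (2 ^ r)) {t t' : ℤ}
    (h : t ≡ t' [ZMOD 2 ^ r]) : β ^ t = β ^ t' := by
  have hβ0 : β ≠ 0 := hβ.ne_zero (by positivity)
  have := (hβ.zpow_eq_one_iff_dvd (t' - t)).2 (by exact_mod_cast h.dvd)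
  rw [zpow_sub₀ hβ0, div_eq_one_iff_eq (zpow_ne_zero _ hβ0)] at this
  exact this.symm

lemma natDegree_minpoly_zpow_le (hcard : Fintype.card F = 2 ^ a * b + 1)
    (hβ : IsPrimitiveRoot β (2 ^ r)) {i : ℕ} (hi : i ≤ r) (u : ℤ) :
    (minpoly F (β ^ (2 ^ (r - i) * u : ℤ))).natDegree ≤ 2 ^ (i - a) := by
  set x := β ^ (2 ^ (r - i) * u : ℤ) with hx
  have h1 : (x ^ 2 ^ (i - a)) ^ (2 ^ a * b) = 1 := by
    have e : (2 : ℤ) ^ (r - i) * 2 ^ (i - a) * 2 ^ a = 2 ^ r * 2 ^ ((r - i) + (i - a) + a - r) := by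
      rw [← pow_add, ← pow_add, ← pow_add]; congr 1; omega
    rw [hx, ← zpow_natCast, ← zpow_natCast, ← zpow_mul, ← zpow_mul, hβ.zpow_eq_one_iff_dvd]
    push_cast
    refine ⟨2 ^ ((r - i) + (i - a) + a - r) * u * b, ?_⟩
    linear_combination (u * b) * e
  obtain ⟨c, hc⟩ := mem_range_of_pow_card_eq (F := F) (x := x ^ 2 ^ (i - a)) (by
    rw [hcard, pow_succ, h1, one_mul])
  have hm : (X ^ 2 ^ (i - a) - C c : F[X]).Monic := monic_X_pow_sub_C c (by positivity)
  refine (natDegree_le_of_dvd (minpoly.dvd F x ?_) hm.ne_zero).trans_eq natDegree_X_pow_sub_C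
  simp [hc]

lemma natDegree_minpoly_of_mem_SD (hcard : Fintype.card F = 2 ^ a * b + 1) (ha : 2 ≤ a)
    (har : a ≤ r) (hβ : IsPrimitiveRoot β (2 ^ r)) {t : ℤ} (ht : t ∈ SD a r) :
    (minpoly F (β ^ t)).natDegree = 1 := by
  refine le_antisymm ?_ (minpoly.natDegree_pos (isIntegral_zpow hβ t))
  rcases mem_SD.1 ht with rfl | rfl | ⟨i, -, hia, u, -, rfl⟩
  · simpa using natDegree_minpoly_zpow_le hcard hβ (i := 0) (by omega) 0
  · simpa [show 1 - a = 0 by omega] using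
      natDegree_minpoly_zpow_le hcard hβ (i := 1) (by omega) 1
  · simpa [show i - a = 0 by omega] using
      natDegree_minpoly_zpow_le hcard hβ (i := i) (by omega) u

lemma mem_SD_of_natDegree_minpoly (hcard : Fintype.card F = 2 ^ a * b + 1) (hb : Odd b)
    (hβ : IsPrimitiveRoot β (2 ^ r)) {t : ℤ} (ht : t ∈ TnD a r)
    (hd : (minpoly F (β ^ t)).natDegree = 1) : t ∈ SD a r := by
  rw [mem_SD]
  rcases mem_TnD.1 ht with h | h | ⟨i, h2, hir, u, hu, rfl⟩
  · exact Or.inl h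
  · exact Or.inr (Or.inl h)
  · refine Or.inr (Or.inr ⟨i, h2, ?_, u, hu, rfl⟩)
    obtain ⟨c, hc⟩ := minpoly.natDegree_eq_one_iff.1 hd
    have hβ0 : β ≠ 0 := hβ.ne_zero (by positivity)
    have h1 : (β ^ (2 ^ (r - i) * u : ℤ)) ^ (2 ^ a * b) = 1 := by
      have hc0 : β ^ (2 ^ (r - i) * u : ℤ) ≠ 0 := zpow_ne_zero _ hβ0
      refine mul_right_cancel₀ hc0 ?_
      rw [← pow_succ, ← hcard, one_mul, ← hc, ← map_pow, FiniteField.pow_card]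
    rw [← zpow_natCast, ← zpow_mul, hβ.zpow_eq_one_iff_dvd] at h1
    push_cast at h1
    by_contra! hia
    have hodd : Odd (u * b) := (odd_of_mem_Dfin hu).mul (by exact_mod_cast hb)
    have h3 : (2 : ℤ) ^ r * 1 = 2 ^ (r - i + a) * 2 ^ (i - a) := by
      rw [← pow_add, mul_one]; congr 1; omega
    have h4 : (2 : ℤ) ^ (r - i + a) * 2 ^ (i - a) ∣ 2 ^ (r - i + a) * (u * b) := by
      rw [← h3, mul_one]
      refine h1.trans (dvd_of_eq ?_)
      rw [pow_add]; ring
    have h5 : (2 : ℤ) ∣ u * b :=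
      (dvd_pow_self 2 (by omega)).trans ((mul_dvd_mul_iff_left (by positivity)).1 h4)
    exact (Int.not_even_iff_odd.2 hodd) (even_iff_two_dvd.2 h5)

lemma exists_mem_TnD_aeval_eq_zero (hcard : Fintype.card F = 2 ^ a * b + 1) (hb : Odd b)
    (ha : 2 ≤ a) (har : a ≤ r) (hβ : IsPrimitiveRoot β (2 ^ r)) (k : ℕ) (hk : k < 2 ^ r) :
    ∃ t ∈ TnD a r, aeval (β ^ k) (minpoly F (β ^ t)) = 0 := by
  rcases Nat.eq_zero_or_pos k with rfl | hk0
  · refine ⟨0, mem_TnD.2 (Or.inl rfl), ?_⟩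
    simp
  obtain ⟨e, u, hu, rfl⟩ := Nat.exists_eq_two_pow_mul_odd hk0.ne'
  have hu' : Odd (u : ℤ) := by exact_mod_cast hu
  have her : e < r := by
    refine (Nat.pow_lt_pow_iff_right (a := 2) (by norm_num)).1 (lt_of_le_of_lt ?_ hk)
    exact Nat.le_mul_of_pos_right _ hu.pos
  rcases (show e = r - 1 ∨ e + 2 ≤ r by omega) with he | he
  · refine ⟨2 ^ (r - 1), mem_TnD.2 (Or.inr (Or.inl rfl)), ?_⟩
    have : β ^ (2 ^ e * u) = β ^ (2 ^ (r - 1) : ℤ) := by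
      rw [← zpow_natCast]
      apply zpow_eq_of_modEq hβ
      obtain ⟨z, hz⟩ := hu'
      refine (Int.modEq_iff_dvd.2 ⟨z, ?_⟩).symm
      have : (2 : ℤ) ^ r = 2 ^ (r - 1) * 2 := by rw [← pow_succ]; congr 1; omega
      push_cast
      rw [this, he, hz]; ring
    rw [this, minpoly.aeval]
  · obtain ⟨i, rfl⟩ : ∃ i, r = e + i := ⟨r - e, by omega⟩
    obtain ⟨w, hw, hmod⟩ := exists_mem_Dfin_modEq ha (show 2 ≤ i by omega) hu'
    refine ⟨2 ^ e * w, mem_TnD.2 (Or.inr (Or.inr ⟨i, by omega, by omega, w, hw, by simp⟩)), ?_⟩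
    have : ∃ l : ℕ, (u : ℤ) ≡ w * (Fintype.card F : ℤ) ^ l [ZMOD 2 ^ i] := by
      rcases le_total i a with h | h
      · rw [min_eq_left h] at hmod
        exact ⟨0, by simpa using hmod⟩
      · rw [min_eq_right h] at hmod
        exact exists_mul_pow_modEq ha h (odd_of_mem_Dfin hw) (e := b) (by exact_mod_cast hb)
          (by rw [hcard]; push_cast; ring) hmod
    obtain ⟨l, hl⟩ := this
    have h1 : β ^ (2 ^ e * u) = (β ^ (2 ^ e * w : ℤ)) ^ Fintype.card F ^ l := by
      rw [← zpow_natCast, ← zpow_natCast, ← zpow_mul]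
      apply zpow_eq_of_modEq hβ
      push_cast
      rw [pow_add, mul_assoc]
      exact hl.mul_left'
    rw [h1]
    exact aeval_pow_card_pow_eq_zero (minpoly.aeval F _) l

lemma sum_natDegree_minpoly_le (hcard : Fintype.card F = 2 ^ a * b + 1)
    (ha : 2 ≤ a) (har : a ≤ r) (hβ : IsPrimitiveRoot β (2 ^ r)) :
    ∑ t ∈ TnD a r, (minpoly F (β ^ t)).natDegree ≤ 2 ^ r := by
  set f : ℤ → ℕ := fun t => (minpoly F (β ^ t)).natDegree with hf
  have h1 : ∑ t ∈ ({0, 2 ^ (r - 1)} : Finset ℤ), f t ≤ 2 := by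
    refine (Finset.sum_le_card_nsmul _ f 1 fun t ht => ?_).trans ?_
    · refine (natDegree_minpoly_of_mem_SD hcard ha har hβ (mem_SD.2 ?_)).le
      simp only [Finset.mem_insert, Finset.mem_singleton] at ht
      tauto
    · simpa using Finset.card_le_two
  have h2 : ∀ i ∈ Finset.Icc 2 r,
      ∑ t ∈ (Dfin a i).image (fun u => 2 ^ (r - i) * u), f t ≤ 2 ^ (i - 1) := by
    intro i hi
    rw [Finset.mem_Icc] at hi
    refine (Finset.sum_le_card_nsmul _ f (2 ^ (i - a)) fun t ht => ?_).trans ?_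
    · obtain ⟨u, -, rfl⟩ := Finset.mem_image.1 ht
      exact natDegree_minpoly_zpow_le hcard hβ hi.2 u
    · rw [smul_eq_mul]
      refine (Nat.mul_le_mul_right _ (Finset.card_image_le.trans (card_Dfin_le a i))).trans_eq ?_
      rw [← pow_succ', ← pow_add]
      congr 1
      omega
  have h3 : ∀ n, ∑ i ∈ Finset.Icc 2 (n + 1), 2 ^ (i - 1) + 2 = 2 ^ (n + 1) := by
    intro n
    induction n with
    | zero => simp
    | succ n ih =>
      rw [Finset.sum_Icc_succ_top (by omega), pow_succ 2 (n + 1)]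
      simp only [Nat.add_sub_cancel]
      omega
  have h4 := h3 (r - 1)
  rw [show r - 1 + 1 = r by omega] at h4
  have h6 := (sum_biUnion_le_sum_sum (Finset.Icc 2 r)
    (fun i => (Dfin a i).image fun u => 2 ^ (r - i) * u) f).trans (Finset.sum_le_sum h2)
  unfold TnD
  have h5 : ∀ s t : Finset ℤ, (s ∪ t).sum f ≤ s.sum f + t.sum f := fun s t =>
    Nat.le.intro Finset.sum_union_inter
  refine (h5 _ _).trans ((add_le_add h1 h6).trans ?_)
  omega

/-- The polynomials `m_t`, for `t` running over `TnD a r`, are the factors of `X ^ 2 ^ r - 1`. -/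
lemma prod_minpoly_zpow (hcard : Fintype.card F = 2 ^ a * b + 1) (hb : Odd b)
    (ha : 2 ≤ a) (har : a ≤ r) (hβ : IsPrimitiveRoot β (2 ^ r)) :
    ∏ t ∈ TnD a r, minpoly F (β ^ t) = X ^ 2 ^ r - 1 := by
  have hm : ∀ t ∈ TnD a r, (minpoly F (β ^ t)).Monic := fun t _ =>
    minpoly.monic (isIntegral_zpow hβ t)
  have hprod := monic_prod_of_monic _ _ hm
  have hX : (X ^ 2 ^ r - 1 : F[X]).Monic := monic_X_pow_sub_C 1 (by positivity)
  have hX' : (X ^ 2 ^ r - 1 : F[X]).natDegree = 2 ^ r := natDegree_X_pow_sub_C (r := 1)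
  have hdvd : (X ^ 2 ^ r - 1 : F[X]) ∣ ∏ t ∈ TnD a r, minpoly F (β ^ t) := by
    rw [← map_dvd_map' (algebraMap F E)]
    have h1 : (X ^ 2 ^ r - 1 : F[X]).map (algebraMap F E) = X ^ 2 ^ r - 1 := by simp
    rw [h1, X_pow_sub_one_eq_prod (by positivity) hβ]
    refine Finset.prod_dvd_of_coprime ?_ ?_
    · intro x _ y _ hxy
      exact isCoprime_X_sub_C_of_isUnit_sub (sub_ne_zero.2 hxy).isUnit
    · intro x hx
      rw [mem_nthRootsFinset (by positivity)] at hx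
      obtain ⟨k, hk, rfl⟩ := hβ.eq_pow_of_pow_eq_one hx
      obtain ⟨t, ht, h⟩ := exists_mem_TnD_aeval_eq_zero hcard hb ha har hβ k hk
      rw [dvd_iff_isRoot, IsRoot, eval_map_algebraMap, map_prod]
      exact Finset.prod_eq_zero ht h
  refine (eq_of_monic_of_dvd_of_natDegree_le hX hprod hdvd ?_)
  rw [natDegree_prod_of_monic _ _ hm, hX']
  exact sum_natDegree_minpoly_le hcard ha har hβ

end Minpoly

/-- `g` generates an MDS cyclic code of length `N`: every nonzero multiple of `g` of degree less
than `N` has at least `deg g + 1` nonzero coefficients. -/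
def IsMDSGenerator {F : Type*} [Field F] (N : ℕ) (g : F[X]) : Prop :=
  ∀ f : F[X], f ≠ 0 → f.natDegree < N → g ∣ f → g.natDegree + 1 ≤ f.support.card

section Generator

variable {F : Type*} [Field F]

lemma natDegree_add_natDegree_of_mul_eq {N : ℕ} (hN : 0 < N) {g h : F[X]}
    (hgh : g * h = X ^ N - 1) : g ≠ 0 ∧ h ≠ 0 ∧ g.natDegree + h.natDegree = N := by
  have h0 : g * h ≠ 0 := by rw [hgh]; exact (monic_X_pow_sub_C 1 hN.ne').ne_zero
  have hg0 : g ≠ 0 := left_ne_zero_of_mul h0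
  have hh0 : h ≠ 0 := right_ne_zero_of_mul h0
  refine ⟨hg0, hh0, ?_⟩
  rw [← natDegree_mul hg0 hh0, hgh]
  exact natDegree_X_pow_sub_C (r := 1)

lemma finrank_degreeLT (k : ℕ) : Module.finrank F (degreeLT F k) = k := by
  rw [(degreeLTEquiv F k).finrank_eq, Module.finrank_fin_fun]

/-- The dual of an MDS code is MDS. -/
lemma IsMDSGenerator.dual {N : ℕ} (hN : 0 < N) {g h : F[X]} (hgh : g * h = X ^ N - 1)
    (hg : IsMDSGenerator N g) : IsMDSGenerator N h := by
  obtain ⟨hg0, hh0, hdeg⟩ := natDegree_add_natDegree_of_mul_eq hN hgh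
  rintro u hu hudeg ⟨v, rfl⟩
  by_contra! hlt
  have hv0 : v ≠ 0 := right_ne_zero_of_mul hu
  rw [natDegree_mul hh0 hv0] at hudeg
  set k := h.natDegree with hk
  set u := h * v with hu_def
  have hsupp : ∀ j ∈ u.support, j < N := fun j hj => by
    have := le_natDegree_of_mem_supp j hj
    rw [hu_def, natDegree_mul hh0 hv0] at this
    omega
  obtain ⟨W, hSW, hWN, hWcard⟩ := Finset.exists_subsuperset_card_eq
    (s := u.support.image fun j => N - 1 - j) (t := Finset.range N) (n := k)
    (by intro x hx
        obtain ⟨j, hj, rfl⟩ := Finset.mem_image.1 hx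
        simp only [Finset.mem_range]; omega)
    (Finset.card_image_le.trans (by omega)) (by rw [Finset.card_range]; omega)
  let L : degreeLT F k →ₗ[F] (W → F) := LinearMap.pi fun w =>
    lcoeff F (w : ℕ) ∘ₗ LinearMap.mulLeft F g ∘ₗ (degreeLT F k).subtype
  have hL : ∀ q w, L q w = (g * (q : F[X])).coeff w := fun q w => rfl
  have hLinj : Function.Injective L := by
    rw [injective_iff_map_eq_zero]
    intro q hq
    by_contra hq0
    have hq0' : (q : F[X]) ≠ 0 := by simpa using hq0
    have hqdeg : (q : F[X]).natDegree < k := by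
      rw [natDegree_lt_iff_degree_lt hq0']
      exact mem_degreeLT.1 q.2
    have hfdeg : (g * (q : F[X])).natDegree < N := by rw [natDegree_mul hg0 hq0']; omega
    have h1 := hg _ (mul_ne_zero hg0 hq0') hfdeg (dvd_mul_right _ _)
    have h2 : (g * (q : F[X])).support ⊆ Finset.range N \ W := by
      intro i hi
      rw [Finset.mem_sdiff, Finset.mem_range]
      refine ⟨(le_natDegree_of_mem_supp i hi).trans_lt hfdeg, fun hiW => ?_⟩
      exact mem_support_iff.1 hi ((hL q ⟨i, hiW⟩).symm.trans (congrFun hq _))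
    have h3 := Finset.card_le_card h2
    rw [Finset.card_sdiff_of_subset hWN, Finset.card_range] at h3
    omega
  have hLsurj : Function.Surjective L := by
    refine (LinearMap.injective_iff_surjective_of_finrank_eq_finrank ?_).1 hLinj
    rw [finrank_degreeLT, Module.finrank_fintype_fun_eq_card, Fintype.card_coe, hWcard]
  obtain ⟨j₀, hj₀⟩ := nonempty_support_iff.2 hu
  have hw₀ : N - 1 - j₀ ∈ W := hSW (Finset.mem_image_of_mem _ hj₀)
  obtain ⟨q, hq⟩ := hLsurj (Pi.single ⟨_, hw₀⟩ 1)
  have hq_coeff : ∀ i ∈ W, (g * (q : F[X])).coeff i = if i = N - 1 - j₀ then 1 else 0 := by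
    intro i hi
    have := congrFun hq ⟨i, hi⟩
    rw [hL] at this
    rw [this, Pi.single_apply]
    simp
  have hcoeff : (g * (q : F[X]) * u).coeff (N - 1) = u.coeff j₀ := by
    rw [coeff_mul, Finset.sum_eq_single (N - 1 - j₀, j₀)]
    · rw [hq_coeff _ hw₀]; simp
    · rintro ⟨i, j⟩ hij hne
      rw [Finset.HasAntidiagonal.mem_antidiagonal] at hij
      by_cases hj : j ∈ u.support
      · have hi : i = N - 1 - j := by simp only at hij; omega
        have hjN := hsupp j hj
        have hj₀N := hsupp j₀ hj₀
        rw [hq_coeff i (hi ▸ hSW (Finset.mem_image_of_mem _ hj)), if_neg, zero_mul]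
        rintro rfl
        apply hne
        ext
        · rfl
        · simp only; omega
      · rw [notMem_support_iff.1 hj, mul_zero]
    · intro hn
      have := hsupp j₀ hj₀
      exact absurd (Finset.HasAntidiagonal.mem_antidiagonal.2 (by omega)) hn
  have hmul : g * (q : F[X]) * u = X ^ N * ((q : F[X]) * v) - (q : F[X]) * v := by
    rw [hu_def, show g * (q : F[X]) * (h * v) = g * h * ((q : F[X]) * v) by ring, hgh]; ring
  refine mem_support_iff.1 hj₀ ?_
  rw [← hcoeff, hmul, coeff_sub, coeff_X_pow_mul', if_neg (by omega), zero_sub, neg_eq_zero]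
  by_cases hq0 : (q : F[X]) = 0
  · simp [hq0]
  · apply coeff_eq_zero_of_natDegree_lt
    have hqdeg : (q : F[X]).natDegree < k := by
      rw [natDegree_lt_iff_degree_lt hq0]
      exact mem_degreeLT.1 q.2
    rw [natDegree_mul hq0 hv0]
    omega

lemma card_support_pow_char_pow_le (p s : ℕ) [ExpChar F p] (f : F[X]) :
    (f ^ p ^ s).support.card ≤ f.natDegree + 1 := by
  rw [← map_iterateFrobenius_expand p]
  refine (Finset.card_le_card (support_map_subset _ _)).trans ?_
  have : (expand F (p ^ s) f).support ⊆ f.support.image fun i => p ^ s * i := by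
    intro i hi
    have hp : 0 < p ^ s := pow_pos (expChar_pos F p) s
    rw [mem_support_iff, coeff_expand hp] at hi
    split_ifs at hi with h
    · exact Finset.mem_image.2 ⟨i / p ^ s, mem_support_iff.2 hi, Nat.mul_div_cancel' h⟩
    · exact absurd rfl hi
  exact (Finset.card_le_card this).trans
    (Finset.card_image_le.trans (card_supp_le_succ_natDegree f))

lemma card_support_X_pow_sub_one_le (n : ℕ) : (X ^ n - 1 : F[X]).support.card ≤ 2 := by
  have : (X ^ n - 1 : F[X]).support ⊆ {n, 0} := by
    intro i hi
    by_contra h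
    simp only [Finset.mem_insert, Finset.mem_singleton, not_or] at h
    refine mem_support_iff.1 hi ?_
    rw [coeff_sub, coeff_X_pow, if_neg h.1, coeff_one, if_neg h.2, sub_zero]
  exact (Finset.card_le_card this).trans Finset.card_le_two

/-- If the exponent of some factor in an MDS generator vanishes, then the generator is trivial
or a single linear factor. -/
lemma IsMDSGenerator.exponents {ι : Type*} {T : Finset ι} {m : ι → F[X]} {n p s : ℕ}
    [ExpChar F p] (hps : 1 < p ^ s) (hn : 0 < n) (hm : ∀ t ∈ T, (m t).Monic)
    (hd : ∀ t ∈ T, 0 < (m t).natDegree) (hprod : ∏ t ∈ T, m t = X ^ n - 1) {j : ι → ℕ}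
    (hj : ∀ t ∈ T, j t ≤ p ^ s) (hg : IsMDSGenerator (n * p ^ s) (∏ t ∈ T, m t ^ j t)) :
    (∀ t ∈ T, j t = 0) ∨
    (∃ t ∈ T, (m t).natDegree = 1 ∧ j t = 1 ∧ ∀ t' ∈ T, t' ≠ t → j t' = 0) ∨
    ∀ t ∈ T, 0 < j t := by
  have hdeg : ∀ e : ι → ℕ, (∏ t ∈ T, m t ^ e t).natDegree = ∑ t ∈ T, e t * (m t).natDegree := by
    intro e
    rw [natDegree_prod_of_monic _ _ fun t ht => (hm t ht).pow _]
    exact Finset.sum_congr rfl fun t ht => (hm t ht).natDegree_pow _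
  have hmon : ∀ e : ι → ℕ, (∏ t ∈ T, m t ^ e t).Monic := fun e =>
    monic_prod_of_monic _ _ fun t ht => (hm t ht).pow _
  have hsum : ∑ t ∈ T, (m t).natDegree = n := by
    rw [← natDegree_prod_of_monic _ _ hm, hprod]
    exact natDegree_X_pow_sub_C (r := 1)
  by_cases hpos : ∀ t ∈ T, 0 < j t
  · exact Or.inr (Or.inr hpos)
  push Not at hpos
  obtain ⟨t₀, ht₀, hjt₀⟩ := hpos
  set ρ : F[X] := ∏ t ∈ T, m t ^ min (j t) 1 with hρ
  have hρdeg : ρ.natDegree < n := by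
    rw [hρ, hdeg, ← hsum]
    refine Finset.sum_lt_sum (fun t _ => ?_) ⟨t₀, ht₀, ?_⟩
    · exact mul_le_of_le_one_left (Nat.zero_le _) (min_le_right _ _)
    · rw [show j t₀ = 0 by omega]; simpa using hd t₀ ht₀
  have hle := hg (ρ ^ p ^ s) ((hmon _).pow _).ne_zero
    (by rw [(hmon _).natDegree_pow, mul_comm]; exact Nat.mul_lt_mul_of_pos_right hρdeg (by omega))
    (by rw [hρ, ← Finset.prod_pow]
        refine Finset.prod_dvd_prod_of_dvd _ _ fun t ht => ?_
        rw [← pow_mul]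
        refine pow_dvd_pow _ ?_
        have := hj t ht
        rcases Nat.eq_zero_or_pos (j t) with h | h
        · omega
        · rwa [min_eq_right h, one_mul])
  have hle' := hle.trans (card_support_pow_char_pow_le p s ρ)
  rw [hρ, hdeg, hdeg] at hle'
  have hj1 : ∀ t ∈ T, j t ≤ 1 := by
    by_contra! hcon
    obtain ⟨t, ht, h1⟩ := hcon
    have : ∑ t ∈ T, min (j t) 1 * (m t).natDegree < ∑ t ∈ T, j t * (m t).natDegree := by
      refine Finset.sum_lt_sum (fun t _ => Nat.mul_le_mul_right _ (min_le_left _ _)) ⟨t, ht, ?_⟩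
      exact Nat.mul_lt_mul_of_pos_right (by omega) (hd t ht)
    omega
  have hle2 := (hg (X ^ n - 1) (monic_X_pow_sub_C 1 hn.ne').ne_zero
    (by rw [show (X ^ n - 1 : F[X]).natDegree = n from natDegree_X_pow_sub_C (r := 1)]
        exact lt_mul_of_one_lt_right hn hps)
    (by rw [← hprod]
        refine Finset.prod_dvd_prod_of_dvd _ _ fun t ht => ?_
        simpa using pow_dvd_pow (m t) (hj1 t ht))).trans (card_support_X_pow_sub_one_le n)
  rw [hdeg] at hle2
  by_cases hzero : ∀ t ∈ T, j t = 0
  · exact Or.inl hzero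
  push Not at hzero
  obtain ⟨t, ht, hjt⟩ := hzero
  refine Or.inr (Or.inl ⟨t, ht, ?_⟩)
  have hjt1 : j t = 1 := le_antisymm (hj1 t ht) (Nat.pos_of_ne_zero hjt)
  rw [← Finset.add_sum_erase _ _ ht, hjt1, one_mul] at hle2
  have := hd t ht
  refine ⟨by omega, hjt1, fun t' ht' hne => ?_⟩
  have h0 : ∑ t ∈ T.erase t, j t * (m t).natDegree = 0 := by omega
  rw [Finset.sum_eq_zero_iff] at h0
  have h0' := h0 t' (Finset.mem_erase.2 ⟨hne, ht'⟩)
  have := hd t' ht'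
  exact (Nat.mul_eq_zero.1 h0').resolve_right this.ne'

lemma card_support_le_of_comp_neg_X_eq (h2 : (2 : F) ≠ 0) {f : F[X]} (hf : f.comp (-X) = f) :
    f.support.card ≤ f.natDegree / 2 + 1 := by
  have : f.support ⊆ (Finset.range (f.natDegree / 2 + 1)).image fun i => 2 * i := by
    intro i hi
    rcases Nat.even_or_odd' i with ⟨k, rfl | rfl⟩
    · have := le_natDegree_of_mem_supp _ hi
      exact Finset.mem_image_of_mem _ (Finset.mem_range.2 (by omega))
    · exfalso
      have h1 : (f.comp (-X)).coeff (2 * k + 1) = -f.coeff (2 * k + 1) := by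
        have := comp_C_mul_X_coeff (p := f) (r := (-1 : F)) (n := 2 * k + 1)
        rw [pow_succ, pow_mul] at this
        simpa using this
      rw [hf] at h1
      refine mem_support_iff.1 hi ?_
      have h3 : (2 : F) * f.coeff (2 * k + 1) = 0 := by linear_combination h1
      exact (mul_eq_zero.1 h3).resolve_left h2
  exact (Finset.card_le_card this).trans (Finset.card_image_le.trans (by simp))

/-- An MDS generator of degree at most `N / 2` is not divisible by `X ^ n - 1` with `n` even. -/
lemma not_isMDSGenerator_X_pow_sub_one_mul (h2 : (2 : F) ≠ 0) {n N : ℕ} (hn : 0 < n)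
    (heven : Even n) {g : F[X]} (hg0 : g ≠ 0)
    (hdeg : 2 * ((X ^ n - 1) * g).natDegree ≤ N) : ¬ IsMDSGenerator N ((X ^ n - 1) * g) := by
  intro hg
  have hX0 : (X ^ n - 1 : F[X]) ≠ 0 := (monic_X_pow_sub_C 1 hn.ne').ne_zero
  have hXdeg : (X ^ n - 1 : F[X]).natDegree = n := natDegree_X_pow_sub_C (r := 1)
  have hc0 : g.comp (-X) ≠ 0 := fun h => hg0 (by rw [← comp_neg_X_comp_neg_X g, h, zero_comp])
  have hcdeg : (g.comp (-X)).natDegree = g.natDegree := by simp [natDegree_comp]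
  have h1 : ((X ^ n - 1) * g * g.comp (-X)).natDegree = n + 2 * g.natDegree := by
    rw [natDegree_mul (mul_ne_zero hX0 hg0) hc0, natDegree_mul hX0 hg0, hXdeg, hcdeg]; ring
  rw [natDegree_mul hX0 hg0, hXdeg] at hdeg
  have h3 := hg _ (mul_ne_zero (mul_ne_zero hX0 hg0) hc0) (by rw [h1]; omega)
    (dvd_mul_right _ _)
  have h4 := card_support_le_of_comp_neg_X_eq h2 (f := (X ^ n - 1) * g * g.comp (-X)) (by
    rw [mul_comp, mul_comp, comp_neg_X_comp_neg_X]
    simp only [sub_comp, pow_comp, X_comp, one_comp, heven.neg_pow]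
    ring)
  rw [h1] at h4
  rw [natDegree_mul hX0 hg0, hXdeg] at h3
  omega

lemma isMDSGenerator_one (N : ℕ) : IsMDSGenerator N (1 : F[X]) := by
  intro f hf _ _
  rw [natDegree_one, zero_add, Nat.one_le_iff_ne_zero, Ne, Finset.card_eq_zero, support_eq_empty]
  exact hf

lemma isMDSGenerator_X_sub_C (N : ℕ) {c : F} (hc : c ≠ 0) : IsMDSGenerator N (X - C c) := by
  intro f hf _ hdvd
  rw [natDegree_X_sub_C]
  by_contra! hlt
  obtain ⟨k, x, rfl⟩ := card_support_le_one_iff_monomial.1 (show f.support.card ≤ 1 by omega)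
  rw [dvd_iff_isRoot, IsRoot, eval_monomial] at hdvd
  rcases mul_eq_zero.1 hdvd with h | h
  · exact hf (by rw [h, monomial_zero_right])
  · exact pow_ne_zero _ hc h

end Generator

section Quotient

variable {F : Type*} [Field F] {f g : F[X]}

lemma coeffRepr_mk (hf : f ≠ 0) {q : F[X]} (hq : q.natDegree < f.natDegree)
    (i : Fin (AdjoinRoot.powerBasis hf).dim) :
    coeffRepr hf (AdjoinRoot.mk f q) i = q.coeff i := by
  have h : AdjoinRoot.mk f q = ∑ i : Fin (AdjoinRoot.powerBasis hf).dim,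
      q.coeff i • (AdjoinRoot.powerBasis hf).basis i := by
    have hlt : q.natDegree < (AdjoinRoot.powerBasis hf).dim := hq
    rw [← AdjoinRoot.aeval_eq, aeval_eq_sum_range' hlt, Finset.sum_range]
    simp only [PowerBasis.basis_eq_pow, AdjoinRoot.powerBasis_gen]
  rw [coeffRepr, h, Module.Basis.repr_sum_self]

lemma hammingWeight_mk (hf : f ≠ 0) {q : F[X]} (hq : q.natDegree < f.natDegree) :
    hammingWeight hf (AdjoinRoot.mk f q) = q.support.card := by
  unfold hammingWeight
  simp only [coeffRepr_mk hf hq]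
  rw [← Finset.card_map Fin.valEmbedding]
  congr 1
  ext i
  simp only [Finset.mem_map, Finset.mem_filter, Finset.mem_univ, true_and, mem_support_iff]
  constructor
  · rintro ⟨k, hk, rfl⟩
    exact hk
  · intro hi
    have : i < (AdjoinRoot.powerBasis hf).dim :=
      (le_natDegree_of_mem_supp i (mem_support_iff.2 hi)).trans_lt hq
    exact ⟨⟨i, this⟩, hi, rfl⟩

lemma mk_mem_span_mk_iff (hgf : g ∣ f) (q : F[X]) :
    AdjoinRoot.mk f q ∈ Ideal.span {AdjoinRoot.mk f g} ↔ g ∣ q := by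
  rw [Ideal.mem_span_singleton]
  constructor
  · rintro ⟨y, hy⟩
    obtain ⟨y, rfl⟩ := AdjoinRoot.mk_surjective y
    rw [← map_mul, AdjoinRoot.mk_eq_mk] at hy
    exact (dvd_sub_left (dvd_mul_right g y)).1 (hgf.trans hy)
  · exact fun h => map_dvd _ h

lemma dHamming_span_mk (hf : f ≠ 0) (hf0 : 0 < f.natDegree) (hgf : g ∣ f) :
    dHamming hf (Ideal.span {AdjoinRoot.mk f g}) =
      sInf {w | ∃ q : F[X], q ≠ 0 ∧ q.natDegree < f.natDegree ∧ g ∣ q ∧ w = q.support.card} := by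
  unfold dHamming
  congr 1
  ext w
  constructor
  · rintro ⟨x, hx, hx0, rfl⟩
    obtain ⟨q, rfl⟩ := AdjoinRoot.mk_surjective x
    have hmod : AdjoinRoot.mk f q = AdjoinRoot.mk f (q % f) := by
      rw [AdjoinRoot.mk_eq_mk]
      exact ⟨q / f, by
        rw [eq_comm, ← sub_eq_zero]
        linear_combination EuclideanDomain.div_add_mod q f⟩
    rw [hmod] at hx hx0 ⊢
    have hdeg : (q % f).natDegree < f.natDegree := natDegree_mod_lt q hf0.ne'
    exact ⟨q % f, fun h => hx0 (by rw [h, map_zero]), hdeg, (mk_mem_span_mk_iff hgf _).1 hx,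
      hammingWeight_mk hf hdeg⟩
  · rintro ⟨q, hq0, hdeg, hgq, rfl⟩
    refine ⟨AdjoinRoot.mk f q, (mk_mem_span_mk_iff hgf q).2 hgq, ?_,
      (hammingWeight_mk hf hdeg).symm⟩
    rw [Ne, AdjoinRoot.mk_eq_zero]
    exact fun h => (natDegree_le_of_dvd h hq0).not_gt hdeg

lemma finrank_span_mk (hf : f ≠ 0) (hgf : g ∣ f) :
    Module.finrank F (Submodule.restrictScalars F (Ideal.span {AdjoinRoot.mk f g})) =
      f.natDegree - g.natDegree := by
  obtain ⟨h, rfl⟩ := hgf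
  have hg0 : g ≠ 0 := left_ne_zero_of_mul hf
  have hh0 : h ≠ 0 := right_ne_zero_of_mul hf
  rw [natDegree_mul hg0 hh0, Nat.add_sub_cancel_left]
  let φ : degreeLT F h.natDegree →ₗ[F] AdjoinRoot (g * h) :=
    (AdjoinRoot.mkₐ (g * h)).toLinearMap ∘ₗ LinearMap.mulLeft F g ∘ₗ
      (degreeLT F h.natDegree).subtype
  have hφ : ∀ q, φ q = AdjoinRoot.mk (g * h) (g * q) := fun q => rfl
  have hinj : Function.Injective φ := by
    rw [injective_iff_map_eq_zero]
    intro q hq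
    rw [hφ, AdjoinRoot.mk_eq_zero, mul_dvd_mul_iff_left hg0] at hq
    have hlt := mem_degreeLT.1 q.2
    rw [← degree_eq_natDegree hh0] at hlt
    exact Subtype.ext (eq_zero_of_dvd_of_degree_lt hq hlt)
  have hrange : LinearMap.range φ =
      Submodule.restrictScalars F (Ideal.span {AdjoinRoot.mk (g * h) g}) := by
    ext x
    rw [LinearMap.mem_range, Submodule.restrictScalars_mem]
    constructor
    · rintro ⟨q, rfl⟩
      rw [hφ, mk_mem_span_mk_iff (dvd_mul_right g h)]
      exact dvd_mul_right _ _
    · intro hx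
      rw [Ideal.mem_span_singleton] at hx
      obtain ⟨y, rfl⟩ := hx
      obtain ⟨y, rfl⟩ := AdjoinRoot.mk_surjective y
      refine ⟨⟨y % h, mem_degreeLT.2 ?_⟩, ?_⟩
      · rw [← degree_eq_natDegree hh0]
        exact EuclideanDomain.mod_lt y hh0
      · rw [hφ, ← map_mul, AdjoinRoot.mk_eq_mk]
        exact ⟨-(y / h), by linear_combination g * EuclideanDomain.div_add_mod y h⟩
  rw [← hrange, LinearMap.finrank_range_of_inj hinj, finrank_degreeLT]

lemma IsMDSGenerator.dHamming_eq (hf : f ≠ 0) (hgf : g ∣ f)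
    (hlt : g.natDegree < f.natDegree) (hg : IsMDSGenerator f.natDegree g) :
    dHamming hf (Ideal.span {AdjoinRoot.mk f g}) = g.natDegree + 1 := by
  have hg0 : g ≠ 0 := ne_zero_of_dvd_ne_zero hf hgf
  rw [dHamming_span_mk hf (by omega) hgf]
  refine le_antisymm ?_ ?_
  · exact le_trans (Nat.sInf_le ⟨g, hg0, hlt, dvd_rfl, rfl⟩) (card_supp_le_succ_natDegree g)
  · refine le_csInf ⟨_, g, hg0, hlt, dvd_rfl, rfl⟩ ?_
    rintro w ⟨q, hq0, hqlt, hgq, rfl⟩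
    exact hg q hq0 hqlt hgq

lemma isMDSGenerator_of_dHamming_eq (hf : f ≠ 0) (hf0 : 0 < f.natDegree) (hgf : g ∣ f)
    (h : dHamming hf (Ideal.span {AdjoinRoot.mk f g}) = g.natDegree + 1) :
    g.natDegree < f.natDegree ∧ IsMDSGenerator f.natDegree g := by
  rw [dHamming_span_mk hf hf0 hgf] at h
  constructor
  · obtain ⟨w, q, hq0, hqlt, hgq, -⟩ :=
      Nat.nonempty_of_pos_sInf (lt_of_lt_of_eq (Nat.succ_pos _) h.symm)
    exact (natDegree_le_of_dvd hgq hq0).trans_lt hqlt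
  · intro q hq0 hqlt hgq
    rw [← h]
    exact Nat.sInf_le ⟨q, hq0, hqlt, hgq, rfl⟩

end Quotient

/-- for `q = p^m = 2^a·b+1` with `2 ≤ a < r`, the cyclic code
`C = ⟨∏_{t∈T_n} m_t^{j_t}⟩ ⊆ F_q[x]/(x^{2^r p^s} − 1)` (with `0 ≤ j_t ≤ p^s`) is MDS iff
exactly one of: (1) all `j_t = 0` (then `d_H(C) = 1`); (2) exactly one `t ∈ S` has
`j_t = 1` and all other exponents are `0` (then `d_H(C) = 2`); (3) exactly one `t ∈ S`
has `j_t = p^s − 1` and all other exponents are `p^s` (then `d_H(C) = 2^r p^s`). -/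
theorem stmt16 (p m a b r s : ℕ) (hp : p.Prime) (hpodd : Odd p) (hm : 0 < m) (hs : 0 < s)
    (hb : Odd b) (ha : 2 ≤ a) (har : a < r) (hq : p ^ m = 2 ^ a * b + 1)
    (F : Type*) [Field F] [Fintype F] (hF : Fintype.card F = p ^ m)
    (E : Type*) [Field E] [Algebra F E] (β : E) (hβ : IsPrimitiveRoot β (2 ^ r))
    (N : ℕ) (hN : N = 2 ^ r * p ^ s) (hf : (X ^ N - 1 : Polynomial F) ≠ 0)
    (j : ℤ → ℕ) (hj : ∀ t ∈ TnD a r, j t ≤ p ^ s)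
    (C : Ideal (AdjoinRoot (X ^ N - 1 : Polynomial F)))
    (hC : C = Ideal.span {AdjoinRoot.mk (X ^ N - 1 : Polynomial F)
      (∏ t ∈ TnD a r, minpoly F (β ^ t) ^ j t)}) :
    (dHamming hf C = N - Module.finrank F (Submodule.restrictScalars F C) + 1 ↔
      (∀ t ∈ TnD a r, j t = 0) ∨
      (∃ t ∈ SD a r, j t = 1 ∧ ∀ t' ∈ TnD a r, t' ≠ t → j t' = 0) ∨
      (∃ t ∈ SD a r, j t = p ^ s - 1 ∧ ∀ t' ∈ TnD a r, t' ≠ t → j t' = p ^ s)) ∧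
    ((∀ t ∈ TnD a r, j t = 0) → dHamming hf C = 1) ∧
    ((∃ t ∈ SD a r, j t = 1 ∧ ∀ t' ∈ TnD a r, t' ≠ t → j t' = 0) →
      dHamming hf C = 2) ∧
    ((∃ t ∈ SD a r, j t = p ^ s - 1 ∧ ∀ t' ∈ TnD a r, t' ≠ t → j t' = p ^ s) →
      dHamming hf C = 2 ^ r * p ^ s) := by
  have hcard := hF.trans hq
  have hT := SD_subset_TnD har.le
  have hps : 1 < p ^ s := Nat.one_lt_pow hs.ne' hp.one_lt
  have hn : 0 < 2 ^ r := by positivity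
  have hN0 : 0 < N := by rw [hN]; positivity
  have := Fact.mk hp
  have : CharP F p := charP_of_card_eq_prime_pow (f := m) hF
  have h2 : (2 : F) ≠ 0 := Ring.two_ne_zero (by
    rw [ringChar.eq F p]
    rintro rfl
    exact absurd hpodd (by decide))
  have hdegf : (X ^ N - 1 : F[X]).natDegree = N := natDegree_X_pow_sub_C (r := 1)
  have hmonic : ∀ t ∈ TnD a r, (minpoly F (β ^ t)).Monic := fun t _ =>
    minpoly.monic (isIntegral_zpow hβ t)
  have hpos : ∀ t ∈ TnD a r, 0 < (minpoly F (β ^ t)).natDegree := fun t _ =>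
    minpoly.natDegree_pos (isIntegral_zpow hβ t)
  have hprod := prod_minpoly_zpow hcard hb ha har.le hβ
  have hgh : (∏ t ∈ TnD a r, minpoly F (β ^ t) ^ j t) *
      ∏ t ∈ TnD a r, minpoly F (β ^ t) ^ (p ^ s - j t) = X ^ N - 1 := by
    have hchar : (X ^ 2 ^ r - 1 : F[X]) ^ p ^ s = X ^ N - 1 := by
      rw [sub_pow_char_pow, one_pow, ← pow_mul, ← hN]
    rw [← Finset.prod_mul_distrib, ← hchar, ← hprod, ← Finset.prod_pow]
    refine Finset.prod_congr rfl fun t ht => ?_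
    rw [← pow_add, Nat.add_sub_cancel' (hj t ht)]
  have hsingle : ∀ k : ℤ → ℕ, ∀ t ∈ TnD a r, k t = 1 → (∀ t' ∈ TnD a r, t' ≠ t → k t' = 0) →
      ∏ t' ∈ TnD a r, minpoly F (β ^ t') ^ k t' = minpoly F (β ^ t) := by
    intro k t ht h1 h0
    rw [Finset.prod_eq_single_of_mem t ht fun t' ht' hne => by rw [h0 t' ht' hne, pow_zero], h1,
      pow_one]
  have hlin : ∀ t ∈ SD a r, IsMDSGenerator N (minpoly F (β ^ t)) := by
    intro t ht
    have h := (hmonic t (hT ht)).eq_X_add_C (natDegree_minpoly_of_mem_SD hcard ha har.le hβ ht)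
    have hc : (minpoly F (β ^ t)).coeff 0 ≠ 0 :=
      minpoly.coeff_zero_ne_zero (isIntegral_zpow hβ t) (zpow_ne_zero _ (hβ.ne_zero hn.ne'))
    rw [h, ← sub_neg_eq_add, ← C_neg]
    exact isMDSGenerator_X_sub_C N (neg_ne_zero.2 hc)
  subst hC
  set g := ∏ t ∈ TnD a r, minpoly F (β ^ t) ^ j t with hgdef
  set h := ∏ t ∈ TnD a r, minpoly F (β ^ t) ^ (p ^ s - j t) with hhdef
  have hgf : g ∣ X ^ N - 1 := ⟨h, hgh.symm⟩
  obtain ⟨hg0, hh0, hdeg⟩ := natDegree_add_natDegree_of_mul_eq hN0 hgh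
  have hdim : N - Module.finrank F (Submodule.restrictScalars F
      (Ideal.span {AdjoinRoot.mk (X ^ N - 1 : F[X]) g})) + 1 = g.natDegree + 1 := by
    rw [finrank_span_mk hf hgf, hdegf]
    omega
  have hdist (hlt : g.natDegree < N) (hg : IsMDSGenerator N g) :=
    IsMDSGenerator.dHamming_eq hf hgf (hdegf.symm ▸ hlt) (hdegf.symm ▸ hg)
  have dist_one : (∀ t ∈ TnD a r, j t = 0) → g.natDegree = 0 ∧
      dHamming hf (Ideal.span {AdjoinRoot.mk (X ^ N - 1 : F[X]) g}) = g.natDegree + 1 := by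
    intro h0
    have hg1 : g = 1 := Finset.prod_eq_one fun t ht => by rw [h0 t ht, pow_zero]
    have hd0 : g.natDegree = 0 := by rw [hg1, natDegree_one]
    exact ⟨hd0, hdist (by omega) (by rw [hg1]; exact isMDSGenerator_one N)⟩
  have hN2 : 1 < N := by rw [hN]; exact lt_of_lt_of_le hps (Nat.le_mul_of_pos_left _ hn)
  have dist_lin : (∃ t ∈ SD a r, j t = 1 ∧ ∀ t' ∈ TnD a r, t' ≠ t → j t' = 0) → g.natDegree = 1 ∧
      dHamming hf (Ideal.span {AdjoinRoot.mk (X ^ N - 1 : F[X]) g}) = g.natDegree + 1 := by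
    rintro ⟨t, ht, h1, h0⟩
    have hg1 := hsingle j t (hT ht) h1 h0
    have hd1 : g.natDegree = 1 := by
      rw [hgdef, hg1, natDegree_minpoly_of_mem_SD hcard ha har.le hβ ht]
    exact ⟨hd1, hdist (by omega) (by rw [hgdef, hg1]; exact hlin t ht)⟩
  have dist_dual : (∃ t ∈ SD a r, j t = p ^ s - 1 ∧ ∀ t' ∈ TnD a r, t' ≠ t → j t' = p ^ s) →
      g.natDegree + 1 = N ∧
      dHamming hf (Ideal.span {AdjoinRoot.mk (X ^ N - 1 : F[X]) g}) = g.natDegree + 1 := by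
    rintro ⟨t, ht, h1, h0⟩
    have hh1 := hsingle (fun t => p ^ s - j t) t (hT ht) (by simp only [h1]; omega)
      fun t' ht' hne => by simp only [h0 t' ht' hne, Nat.sub_self]
    have hd1 : h.natDegree = 1 := by
      rw [hhdef, hh1, natDegree_minpoly_of_mem_SD hcard ha har.le hβ ht]
    refine ⟨by omega, hdist (by omega) ?_⟩
    refine IsMDSGenerator.dual hN0 ((mul_comm h g).trans hgh) ?_
    rw [hhdef, hh1]
    exact hlin t ht
  refine ⟨?_, fun hc => ?_, fun hc => ?_, fun hc => ?_⟩
  · rw [hdim]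
    refine ⟨fun hd => ?_, fun hc => ?_⟩
    · obtain ⟨hlt, hg⟩ := isMDSGenerator_of_dHamming_eq hf (hdegf.symm ▸ hN0) hgf hd
      rw [hdegf] at hlt hg
      have hh := hg.dual hN0 hgh
      have hgN := hg
      have hhN := hh
      rw [hN] at hgN hhN
      have hfactor : ∀ k : ℤ → ℕ, (∀ t ∈ TnD a r, 0 < k t) →
          ∏ t ∈ TnD a r, minpoly F (β ^ t) ^ k t =
            (X ^ 2 ^ r - 1) * ∏ t ∈ TnD a r, minpoly F (β ^ t) ^ (k t - 1) := by
        intro k hk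
        rw [← hprod, ← Finset.prod_mul_distrib]
        refine Finset.prod_congr rfl fun t ht => ?_
        rw [← pow_succ', Nat.sub_add_cancel (hk t ht)]
      have hsmall : ∀ k : ℤ → ℕ, (∀ t ∈ TnD a r, 0 < k t) →
          2 * (∏ t ∈ TnD a r, minpoly F (β ^ t) ^ k t).natDegree ≤ N →
          ¬ IsMDSGenerator N (∏ t ∈ TnD a r, minpoly F (β ^ t) ^ k t) := by
        intro k hk
        rw [hfactor k hk]
        exact not_isMDSGenerator_X_pow_sub_one_mul h2 hn
          (Nat.even_pow.2 ⟨even_two, by omega⟩)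
          (monic_prod_of_monic _ _ fun t ht => (hmonic t ht).pow _).ne_zero
      rcases hgN.exponents hps hn hmonic hpos hprod hj with h1 | ⟨t, ht, h1, h3, h4⟩ | hjpos
      · exact Or.inl h1
      · exact Or.inr (Or.inl ⟨t, mem_SD_of_natDegree_minpoly hcard hb hβ ht h1, h3, h4⟩)
      rcases hhN.exponents hps hn hmonic hpos hprod fun t _ => Nat.sub_le _ _ with
        h1 | ⟨t, ht, h1, h3, h4⟩ | hjlt
      · have : h = 1 := Finset.prod_eq_one fun t ht => by rw [h1 t ht, pow_zero]
        rw [this, natDegree_one] at hdeg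
        omega
      · refine Or.inr (Or.inr ⟨t, mem_SD_of_natDegree_minpoly hcard hb hβ ht h1, by omega,
          fun t' ht' hne => ?_⟩)
        have := h4 t' ht' hne
        have := hj t' ht'
        omega
      · rcases le_total g.natDegree h.natDegree with hle | hle
        · exact (hsmall j hjpos (by rw [← hgdef]; omega) hg).elim
        · exact (hsmall _ hjlt (by rw [← hhdef]; omega) hh).elim
    · rcases hc with hc | hc | hc
      · exact (dist_one hc).2
      · exact (dist_lin hc).2
      · exact (dist_dual hc).2
  · rw [(dist_one hc).2, (dist_one hc).1]
  · rw [(dist_lin hc).2, (dist_lin hc).1]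
  · rw [(dist_dual hc).2, (dist_dual hc).1, hN]
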